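/- arXiv:1401.6101 — 2 statements merged into one kernel-verified Lean document; each statement's English description precedes it below -/
import Mathlib

section
/- Let C⁺ ⊆ (⋀²W)⊗W be the set of cosyzygies consisting of: (x_0∧x_i)⊗x_j for 1 ≤ i ≤ 2k−1 and 0 ≤ j ≤ 2k−1; (x_0∧x_i)⊗x_{2k} for 1 ≤ i ≤ k−1; (x_0∧x_{2k})⊗x_i for 0 ≤ i ≤ k−1; (x_{2k}∧x_i)⊗x_j for 1 ≤ i ≤ 2k−1 and 1 ≤ j ≤ 2k; (x_{2k}∧x_0)⊗x_i for k+1 ≤ i ≤ 2k; (x_{2k}∧x_i)⊗x_0 for k+1 ≤ i ≤ 2k−1; (x_k∧x_i)⊗x_j for i ∈ {1,…,2k−1}∖{k} and 1 ≤ j ≤ 2k−1; (x_k∧x_0)⊗x_{2k}; (x_k∧x_{2k})⊗x_0; (x_i∧x_{k+i})⊗x_{k−i} for 1 ≤ i ≤ k−1; and (x_{2k−i}∧x_{k−i})⊗x_{k+i} for 1 ≤ i ≤ k−1. Then C⁺ consists of (3g−5)(g−1) cosyzygies, C⁺ is a monomial basis of cosyzygies (its image under f₂ is a basis of ker f₁),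 and for each index i with 0 ≤ i ≤ 2k the total number of occurrences of i among the entries of the triples of C⁺ equals g²−1 if i ∈ {0, k, 2k} and 6g−6 otherwise. -/
set_option synthInstance.maxHeartbeats 400000
set_option maxHeartbeats 1000000

noncomputable section

open scoped TensorProduct

/-- The coordinate ring `A = ℂ[u,ε]/(ε²)` of the chart `U` of the balanced ribbon. -/
def A : Type := DualNumber (Polynomial ℂ)

instance : CommRing A := inferInstanceAs (CommRing (DualNumber (Polynomial ℂ)))
instance : Algebra ℂ A := inferInstanceAs (Algebra ℂ (DualNumber (Polynomial ℂ)))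

def uu : A := TrivSqZeroExt.inl Polynomial.X
def ee : A := DualNumber.eps

/-- The restrictions to `U` of the standard basis of `H⁰(ω)` of the balanced ribbon. -/
def x (k i : ℕ) : A :=
  if i ≤ k then uu ^ i else uu ^ i + ((i - k : ℕ) : A) * uu ^ (i - k - 1) * ee

/-- `V_m`: the span of the degree-`m` monomials in `x_0, …, x_{2k}`. -/
def V (k m : ℕ) : Submodule ℂ A :=
  Submodule.span ℂ {a | ∃ f : Fin m → ℕ, (∀ j, f j ≤ 2 * k) ∧ a = ∏ j, x k (f j)}

/-- `W = span ℂ {x_0, …, x_{2k}}`. -/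
def W (k : ℕ) : Submodule ℂ A := Submodule.span ℂ (x k '' Set.Iic (2 * k))

def xW (k i : ℕ) : ↥(W k) :=
  if h : i ≤ 2 * k then ⟨x k i, Submodule.subset_span ⟨i, h, rfl⟩⟩ else 0

def xV2 (k i j : ℕ) : ↥(V k 2) :=
  if h : i ≤ 2 * k ∧ j ≤ 2 * k then
    ⟨x k i * x k j, Submodule.subset_span ⟨![i, j], by
      refine ⟨?_, ?_⟩
      · intro t
        fin_cases t
        · simpa using h.1
        · simpa using h.2
      · simp [Fin.prod_univ_two]⟩⟩
  else 0

/-- The Koszul differential `f₁ : W ⊗ V₂ → V₃ ⊆ A`, `x ⊗ q ↦ x·q`. -/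
def f1 (k : ℕ) : (↥(W k) ⊗[ℂ] ↥(V k 2)) →ₗ[ℂ] A :=
  TensorProduct.lift (((LinearMap.mul ℂ A).comp (W k).subtype).compl₂ (V k 2).subtype)

/-- The image under the Koszul differential `f₂` of the cosyzygy `(x_a ∧ x_b) ⊗ x_c`,
namely `x_b ⊗ x_a x_c − x_a ⊗ x_b x_c ∈ W ⊗ V₂`. -/
def cosz (k a b c : ℕ) : ↥(W k) ⊗[ℂ] ↥(V k 2) :=
  xW k b ⊗ₜ[ℂ] xV2 k a c - xW k a ⊗ₜ[ℂ] xV2 k b c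

/-- A finite set `S` of triples is a monomial basis of cosyzygies if the family
`f₂((x_a ∧ x_b) ⊗ x_c) = x_b ⊗ x_a x_c − x_a ⊗ x_b x_c`, `(a,b,c) ∈ S`,
is a basis of `ker f₁`. -/
def IsMonomialBasisOfCosyzygies (k : ℕ) (S : Finset (ℕ × ℕ × ℕ)) : Prop :=
  LinearIndependent ℂ (fun t : S => cosz k t.1.1 t.1.2.1 t.1.2.2) ∧
  Submodule.span ℂ ((fun t : ℕ × ℕ × ℕ => cosz k t.1 t.2.1 t.2.2) '' ↑S) =
    LinearMap.ker (f1 k)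

/-- The number of occurrences of the index `i` among the entries of the triples of `S`. -/
def occ (S : Finset (ℕ × ℕ × ℕ)) (i : ℕ) : ℕ :=
  ∑ t ∈ S, ((if t.1 = i then 1 else 0) + (if t.2.1 = i then 1 else 0) +
    (if t.2.2 = i then 1 else 0))

open Classical in
/-- The set `C⁺` of cosyzygies, encoded as triples `(a,b,c) ↔ (x_a ∧ x_b) ⊗ x_c`. -/
def Splus (k : ℕ) : Finset (ℕ × ℕ × ℕ) :=
  (Finset.range (2 * k + 1) ×ˢ Finset.range (2 * k + 1) ×ˢ Finset.range (2 * k + 1)).filter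
    fun t =>
      (t.1 = 0 ∧ 1 ≤ t.2.1 ∧ t.2.1 ≤ 2 * k - 1 ∧ t.2.2 ≤ 2 * k - 1) ∨
      (t.1 = 0 ∧ 1 ≤ t.2.1 ∧ t.2.1 ≤ k - 1 ∧ t.2.2 = 2 * k) ∨
      (t.1 = 0 ∧ t.2.1 = 2 * k ∧ t.2.2 ≤ k - 1) ∨
      (t.1 = 2 * k ∧ 1 ≤ t.2.1 ∧ t.2.1 ≤ 2 * k - 1 ∧ 1 ≤ t.2.2 ∧ t.2.2 ≤ 2 * k) ∨
      (t.1 = 2 * k ∧ t.2.1 = 0 ∧ k + 1 ≤ t.2.2 ∧ t.2.2 ≤ 2 * k) ∨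
      (t.1 = 2 * k ∧ k + 1 ≤ t.2.1 ∧ t.2.1 ≤ 2 * k - 1 ∧ t.2.2 = 0) ∨
      (t.1 = k ∧ 1 ≤ t.2.1 ∧ t.2.1 ≤ 2 * k - 1 ∧ t.2.1 ≠ k ∧
        1 ≤ t.2.2 ∧ t.2.2 ≤ 2 * k - 1) ∨
      (t = (k, 0, 2 * k)) ∨ (t = (k, 2 * k, 0)) ∨
      (∃ i, 1 ≤ i ∧ i ≤ k - 1 ∧ t = (i, k + i, k - i)) ∨
      (∃ i, 1 ≤ i ∧ i ≤ k - 1 ∧ t = (2 * k - i, k - i, k + i))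

lemma mem_Splus {k a b c : ℕ} : (a, b, c) ∈ Splus k ↔
    (a ≤ 2 * k ∧ b ≤ 2 * k ∧ c ≤ 2 * k) ∧
    ((a = 0 ∧ 1 ≤ b ∧ b ≤ 2 * k - 1 ∧ c ≤ 2 * k - 1) ∨
      (a = 0 ∧ 1 ≤ b ∧ b ≤ k - 1 ∧ c = 2 * k) ∨
      (a = 0 ∧ b = 2 * k ∧ c ≤ k - 1) ∨
      (a = 2 * k ∧ 1 ≤ b ∧ b ≤ 2 * k - 1 ∧ 1 ≤ c ∧ c ≤ 2 * k) ∨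
      (a = 2 * k ∧ b = 0 ∧ k + 1 ≤ c ∧ c ≤ 2 * k) ∨
      (a = 2 * k ∧ k + 1 ≤ b ∧ b ≤ 2 * k - 1 ∧ c = 0) ∨
      (a = k ∧ 1 ≤ b ∧ b ≤ 2 * k - 1 ∧ b ≠ k ∧ 1 ≤ c ∧ c ≤ 2 * k - 1) ∨
      (a = k ∧ b = 0 ∧ c = 2 * k) ∨ (a = k ∧ b = 2 * k ∧ c = 0) ∨
      (1 ≤ a ∧ a ≤ k - 1 ∧ b = k + a ∧ c = k - a) ∨
      (k + 1 ≤ a ∧ a ≤ 2 * k - 1 ∧ b = a - k ∧ c = 3 * k - a)) := by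
  have h₁ : (∃ i, 1 ≤ i ∧ i ≤ k - 1 ∧ a = i ∧ b = k + i ∧ c = k - i) ↔
      (1 ≤ a ∧ a ≤ k - 1 ∧ b = k + a ∧ c = k - a) :=
    ⟨by rintro ⟨i, h⟩; omega, fun h => ⟨a, by omega⟩⟩
  have h₂ : (∃ i, 1 ≤ i ∧ i ≤ k - 1 ∧ a = 2 * k - i ∧ b = k - i ∧ c = k + i) ↔
      (k + 1 ≤ a ∧ a ≤ 2 * k - 1 ∧ b = a - k ∧ c = 3 * k - a) :=
    ⟨by rintro ⟨i, h⟩; omega, fun h => ⟨2 * k - a, by omega⟩⟩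
  simp only [Splus, Finset.mem_filter, Finset.mem_product, Finset.mem_range, Prod.mk.injEq, h₁, h₂,
    Nat.lt_succ_iff]

lemma reflect_mem_Splus {k a b c : ℕ} (hk : 1 ≤ k) (h : (a, b, c) ∈ Splus k) :
    (2 * k - a, 2 * k - b, 2 * k - c) ∈ Splus k := by
  rw [mem_Splus] at h ⊢
  obtain ⟨hb, h | h | h | h | h | h | h | h | h | h | h⟩ := h
  · exact ⟨by omega, .inr <| .inr <| .inr <| .inl (by omega)⟩
  · exact ⟨by omega, .inr <| .inr <| .inr <| .inr <| .inr <| .inl (by omega)⟩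
  · exact ⟨by omega, .inr <| .inr <| .inr <| .inr <| .inl (by omega)⟩
  · exact ⟨by omega, .inl (by omega)⟩
  · exact ⟨by omega, .inr <| .inr <| .inl (by omega)⟩
  · exact ⟨by omega, .inr <| .inl (by omega)⟩
  · exact ⟨by omega, .inr <| .inr <| .inr <| .inr <| .inr <| .inr <| .inl (by omega)⟩
  · exact ⟨by omega, .inr <| .inr <| .inr <| .inr <| .inr <| .inr <| .inr <| .inr <|
      .inl (by omega)⟩
  · exact ⟨by omega, .inr <| .inr <| .inr <| .inr <| .inr <| .inr <| .inr <| .inl (by omega)⟩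
  · exact ⟨by omega, .inr <| .inr <| .inr <| .inr <| .inr <| .inr <| .inr <| .inr <| .inr <| .inr <|
      by omega⟩
  · exact ⟨by omega, .inr <| .inr <| .inr <| .inr <| .inr <| .inr <| .inr <| .inr <| .inr <|
      .inl (by omega)⟩

/-- The multiplicity `s_i` of `ε` in `x_i = u^i + s_i u^(i-k-1) ε`. -/
def epsCoeff (k i : ℕ) : ℂ := ((i - k : ℕ) : ℂ)

lemma epsCoeff_reflect (k i : ℕ) : epsCoeff k (2 * k - i) = epsCoeff k i + k - i := by
  have : 2 * k - i - k + i = i - k + k := by omega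
  have := congrArg (Nat.cast (R := ℂ)) this
  push_cast at this
  simp only [epsCoeff]
  linear_combination this

lemma epsCoeff_eq_of_sum {k a b a' b' : ℕ} (h : (a - k) + (b - k) = (a' - k) + (b' - k)) :
    epsCoeff k a + epsCoeff k b = epsCoeff k a' + epsCoeff k b' := by
  simp only [epsCoeff]
  exact_mod_cast h

lemma epsCoeff_ne_of_sum {k a b a' b' : ℕ} (h : (a - k) + (b - k) ≠ (a' - k) + (b' - k)) :
    epsCoeff k a + epsCoeff k b ≠ epsCoeff k a' + epsCoeff k b' := by
  simp only [epsCoeff]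
  exact_mod_cast h

/-- The relations satisfied by the classes `T i a b` of `x_i ⊗ x_a x_b` modulo the cosyzygies
in `C⁺`: those coming from the relations between the products `x_a x_b` in `V₂`, and those
coming from `C⁺`. -/
structure CosyzygyRelations (k : ℕ) {M : Type*} [AddCommGroup M] [Module ℂ M]
    (T : ℕ → ℕ → ℕ → M) : Prop where
  symm : ∀ i a b, T i a b = T i b a
  affine : ∀ i a b a' b' a'' b'', a ≤ 2 * k → b ≤ 2 * k → a' ≤ 2 * k → b' ≤ 2 * k →
    a'' ≤ 2 * k → b'' ≤ 2 * k → a + b = a' + b' → a + b = a'' + b'' →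
    (epsCoeff k a' + epsCoeff k b' - (epsCoeff k a'' + epsCoeff k b'')) • T i a b +
    (epsCoeff k a'' + epsCoeff k b'' - (epsCoeff k a + epsCoeff k b)) • T i a' b' +
    (epsCoeff k a + epsCoeff k b - (epsCoeff k a' + epsCoeff k b')) • T i a'' b'' = 0
  congr : ∀ i a b a' b', a ≤ 2 * k → b ≤ 2 * k → a' ≤ 2 * k → b' ≤ 2 * k →
    a + b = a' + b' → epsCoeff k a + epsCoeff k b = epsCoeff k a' + epsCoeff k b' →
      T i a b = T i a' b'
  rel : ∀ a b c, (a, b, c) ∈ Splus k → T b a c = T a b c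

/-- `T i a b` is the value at `s_i + s_a + s_b` of the affine function `s ↦ E + s F`. -/
def IsAffineAt (k : ℕ) {M : Type*} [AddCommGroup M] [Module ℂ M]
    (T : ℕ → ℕ → ℕ → M) (E F : M) (i a b : ℕ) : Prop :=
  T i a b = E + (epsCoeff k i + epsCoeff k a + epsCoeff k b) • F

namespace CosyzygyRelations

variable {k : ℕ} {M : Type*} [AddCommGroup M] [Module ℂ M] {T : ℕ → ℕ → ℕ → M}

lemma reflect (hk : 1 ≤ k) (h : CosyzygyRelations k T) :
    CosyzygyRelations k fun i a b => T (2 * k - i) (2 * k - a) (2 * k - b) where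
  symm i a b := h.symm _ _ _
  affine i a b a' b' a'' b'' ha hb ha' hb' ha'' hb'' h₁ h₂ := by
    have := h.affine (2 * k - i) (2 * k - a) (2 * k - b) (2 * k - a') (2 * k - b') (2 * k - a'')
      (2 * k - b'') (by omega) (by omega) (by omega) (by omega) (by omega) (by omega) (by omega)
      (by omega)
    simp only [epsCoeff_reflect] at this
    have e₁ : (a : ℂ) + b = a' + b' := by exact_mod_cast h₁
    have e₂ : (a : ℂ) + b = a'' + b'' := by exact_mod_cast h₂
    refine Eq.trans (congrArg₂ (· + ·) (congrArg₂ (· + ·) (congrArg (· • _) ?_)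
      (congrArg (· • _) ?_)) (congrArg (· • _) ?_)) this
    · linear_combination e₂ - e₁
    · linear_combination -e₂
    · linear_combination e₁
  congr i a b a' b' ha hb ha' hb' h₁ h₂ := by
    apply h.congr <;> try omega
    have e₁ : (a : ℂ) + b = a' + b' := by exact_mod_cast h₁
    simp only [epsCoeff_reflect]
    linear_combination h₂ - e₁
  rel a b c hm := h.rel _ _ _ (reflect_mem_Splus hk hm)

variable {E F : M}

lemma isAffineAt_swap (h : CosyzygyRelations k T) {i a b : ℕ} (hi : IsAffineAt k T E F i a b) :
    IsAffineAt k T E F i b a := by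
  unfold IsAffineAt at *
  rw [h.symm, hi]
  module

lemma isAffineAt_of_mem (h : CosyzygyRelations k T) {a b c : ℕ} (hm : (a, b, c) ∈ Splus k)
    (hi : IsAffineAt k T E F a b c) : IsAffineAt k T E F b a c := by
  unfold IsAffineAt at *
  rw [h.rel _ _ _ hm, hi]
  module

lemma isAffineAt_of_mem' (h : CosyzygyRelations k T) {a b c : ℕ} (hm : (b, a, c) ∈ Splus k)
    (hi : IsAffineAt k T E F a b c) : IsAffineAt k T E F b a c := by
  unfold IsAffineAt at *
  rw [← h.rel _ _ _ hm, hi]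
  module

lemma isAffineAt_congr (h : CosyzygyRelations k T) {i a b a' b' : ℕ} (ha : a ≤ 2 * k)
    (hb : b ≤ 2 * k) (ha' : a' ≤ 2 * k) (hb' : b' ≤ 2 * k) (hs : a + b = a' + b')
    (hc : (a - k) + (b - k) = (a' - k) + (b' - k))
    (hi : IsAffineAt k T E F i a' b') : IsAffineAt k T E F i a b := by
  unfold IsAffineAt at *
  have e := epsCoeff_eq_of_sum hc
  rw [h.congr i a b a' b' ha hb ha' hb' hs e, hi, add_assoc, ← e, add_assoc]

lemma isAffineAt_of_two (h : CosyzygyRelations k T) {i a b a' b' a'' b'' : ℕ} (ha : a ≤ 2 * k)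
    (hb : b ≤ 2 * k) (ha' : a' ≤ 2 * k) (hb' : b' ≤ 2 * k) (ha'' : a'' ≤ 2 * k)
    (hb'' : b'' ≤ 2 * k) (hs : a + b = a' + b') (hs' : a + b = a'' + b'')
    (hc : (a' - k) + (b' - k) ≠ (a'' - k) + (b'' - k))
    (hi : IsAffineAt k T E F i a' b') (hi' : IsAffineAt k T E F i a'' b'') :
    IsAffineAt k T E F i a b := by
  unfold IsAffineAt at *
  have e := sub_ne_zero.2 (epsCoeff_ne_of_sum hc)
  have := h.affine i a b a' b' a'' b'' ha hb ha' hb' ha'' hb'' hs hs'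
  rw [hi, hi'] at this
  rw [← sub_eq_zero]
  refine (smul_eq_zero.1 ?_).resolve_left e
  rw [← this]
  module

/-- The weight-`m` part of `x_i ⊗ V₂` is controlled by the products of `x_a x_b` of weight `m`
with maximal and minimal coefficient of `ε`. -/
lemma isAffineAt_of_extremes (h : CosyzygyRelations k T) {i m : ℕ}
    (h0 : m ≤ 2 * k → IsAffineAt k T E F i 0 m)
    (h2k : 2 * k < m → m ≤ 4 * k → IsAffineAt k T E F i (2 * k) (m - 2 * k))
    (hk : k < m → m < 3 * k → IsAffineAt k T E F i k (m - k))
    {a b : ℕ} (ha : a ≤ 2 * k) (hb : b ≤ 2 * k) (hm : a + b = m) :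
    IsAffineAt k T E F i a b := by
  rcases le_or_gt m (2 * k) with h₁ | h₁
  · rcases le_or_gt m k with h₂ | h₂
    · exact h.isAffineAt_congr ha hb (by omega) (by omega) (by omega) (by omega) (h0 h₁)
    · exact h.isAffineAt_of_two ha hb (by omega) (by omega) (by omega) (by omega) (by omega)
        (by omega) (by omega) (h0 h₁) (hk h₂ (by omega))
  · rcases le_or_gt (3 * k) m with h₂ | h₂
    · exact h.isAffineAt_congr ha hb (by omega) (by omega) (by omega) (by omega)
        (h2k h₁ (by omega))
    · exact h.isAffineAt_of_two ha hb (by omega) (by omega) (by omega) (by omega) (by omega)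
        (by omega) (by omega) (h2k h₁ (by omega)) (hk (by omega) h₂)

lemma exists_isAffineAt_two (T : ℕ → ℕ → ℕ → M) {i a b a' b' : ℕ}
    (hc : (a - k) + (b - k) ≠ (a' - k) + (b' - k)) :
    ∃ E F, IsAffineAt k T E F i a b ∧ IsAffineAt k T E F i a' b' := by
  have e := sub_ne_zero.2 (epsCoeff_ne_of_sum hc)
  set c := epsCoeff k a + epsCoeff k b with hc₁
  set c' := epsCoeff k a' + epsCoeff k b' with hc₂
  refine ⟨T i a b - (epsCoeff k i + c) • (c - c')⁻¹ • (T i a b - T i a' b'),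
    (c - c')⁻¹ • (T i a b - T i a' b'), ?_, ?_⟩
  · unfold IsAffineAt
    rw [add_assoc, ← hc₁]
    module
  · unfold IsAffineAt
    rw [add_assoc, ← hc₂]
    have : T i a b - T i a' b' = (c - c') • (c - c')⁻¹ • (T i a b - T i a' b') := by
      rw [smul_smul, mul_inv_cancel₀ e, one_smul]
    generalize (c - c')⁻¹ • (T i a b - T i a' b') = D at *
    rw [sub_eq_iff_eq_add] at this
    rw [this]
    module

lemma exists_isAffineAt_slot (h : CosyzygyRelations k T) (i m : ℕ) :
    ∃ E F, ∀ a b, a ≤ 2 * k → b ≤ 2 * k → a + b = m → IsAffineAt k T E F i a b := by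
  by_cases hm : k < m ∧ m < 3 * k
  · rcases le_or_gt m (2 * k) with h₁ | h₁
    · obtain ⟨E, F, h₂, h₃⟩ := exists_isAffineAt_two (k := k) T
        (i := i) (a := 0) (b := m) (a' := k) (b' := m - k) (by omega)
      exact ⟨E, F, fun a b ha hb hab => h.isAffineAt_of_extremes (m := m) (fun _ => h₂)
        (fun _ _ => by omega) (fun _ _ => h₃) ha hb hab⟩
    · obtain ⟨E, F, h₂, h₃⟩ := exists_isAffineAt_two (k := k) T
        (i := i) (a := 2 * k) (b := m - 2 * k) (a' := k) (b' := m - k) (by omega)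
      exact ⟨E, F, fun a b ha hb hab => h.isAffineAt_of_extremes (m := m) (fun _ => by omega)
        (fun _ _ => h₂) (fun _ _ => h₃) ha hb hab⟩
  · rcases le_or_gt m (2 * k) with h₁ | h₁
    · refine ⟨T i 0 m, 0, fun a b ha hb hab => h.isAffineAt_of_extremes (m := m) (fun _ => ?_)
        (fun _ _ => by omega) (fun _ _ => by omega) ha hb hab⟩
      simp [IsAffineAt]
    · refine ⟨T i (2 * k) (m - 2 * k), 0, fun a b ha hb hab => h.isAffineAt_of_extremes (m := m)
        (fun _ => by omega) (fun _ _ => ?_) (fun _ _ => by omega) ha hb hab⟩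
      simp [IsAffineAt]

/-- In weight at most `3k`, the slots `0`, `k` and `2k` control all the others. -/
lemma isAffineAt_of_slots (h : CosyzygyRelations k T) {d : ℕ} (hd : d ≤ 3 * k)
    (h0 : ∀ a b, a ≤ 2 * k → b ≤ 2 * k → a + b = d → IsAffineAt k T E F 0 a b)
    (hk : ∀ a b, a ≤ 2 * k → b ≤ 2 * k → k + a + b = d → IsAffineAt k T E F k a b)
    (h2k : ∀ a b, a ≤ 2 * k → b ≤ 2 * k → 2 * k + a + b = d → IsAffineAt k T E F (2 * k) a b)
    {i a b : ℕ} (hi : i ≤ 2 * k) (ha : a ≤ 2 * k) (hb : b ≤ 2 * k) (hs : i + a + b = d) :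
    IsAffineAt k T E F i a b := by
  by_cases i0 : i = 0
  · subst i0; exact h0 a b ha hb (by omega)
  by_cases ik : i = k
  · subst ik; exact hk a b ha hb hs
  by_cases i2k : i = 2 * k
  · subst i2k; exact h2k a b ha hb hs
  refine h.isAffineAt_of_extremes (m := d - i) (fun h₁ => ?_) (fun h₁ h₂ => ?_) (fun h₁ h₂ => ?_)
    ha hb (by omega)
  · have hm : (0, i, d - i) ∈ Splus k := by
      rcases h₁.lt_or_eq with h₂ | h₂
      · exact mem_Splus.2 ⟨by omega, .inl (by omega)⟩
      · exact mem_Splus.2 ⟨by omega, .inr <| .inl (by omega)⟩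
    exact h.isAffineAt_of_mem hm (h0 _ _ hi h₁ (by omega))
  · exact h.isAffineAt_of_mem (mem_Splus.2 ⟨by omega, .inr <| .inr <| .inr <| .inl (by omega)⟩)
      (h2k _ _ hi (by omega) (by omega))
  · exact h.isAffineAt_of_mem (mem_Splus.2 ⟨by omega, .inr <| .inr <| .inr <| .inr <| .inr <|
      .inr <| .inl (by omega)⟩) (hk _ _ hi (by omega) (by omega))

lemma exists_isAffineAt_of_le (hk2 : 2 ≤ k) (h : CosyzygyRelations k T) {d : ℕ}
    (hd : d ≤ 3 * k) : ∃ E F, ∀ i a b, i ≤ 2 * k → a ≤ 2 * k → b ≤ 2 * k → i + a + b = d →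
      IsAffineAt k T E F i a b := by
  rcases hd.lt_or_eq with hd' | rfl
  · obtain ⟨E, F, h0⟩ := h.exists_isAffineAt_slot 0 d
    refine ⟨E, F, fun i a b => h.isAffineAt_of_slots hd h0 (fun a b ha hb hs => ?_)
      (fun a b ha hb hs => ?_)⟩
    · refine h.isAffineAt_of_extremes (m := d - k) (fun h₁ => ?_) (fun h₁ h₂ => by omega)
        (fun h₁ h₂ => ?_) ha hb (by omega)
      · exact h.isAffineAt_of_mem (mem_Splus.2 ⟨by omega, .inl (by omega)⟩)
          (h0 _ _ (by omega) (by omega) (by omega))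
      · obtain ⟨j, rfl⟩ : ∃ j, d = 2 * k + j := ⟨d - 2 * k, by omega⟩
        rw [show 2 * k + j - k - k = j by omega]
        refine h.isAffineAt_swap (h.isAffineAt_of_mem' (mem_Splus.2 ⟨by omega, .inr <| .inr <|
          .inr <| .inr <| .inr <| .inr <| .inl (by omega)⟩) ?_)
        have h₃ : IsAffineAt k T E F j 0 (2 * k) := h.isAffineAt_of_mem
          (mem_Splus.2 ⟨by omega, .inr <| .inl (by omega)⟩)
          (h0 _ _ (by omega) (by omega) (by omega))
        have h₄ : IsAffineAt k T E F (k + j) 0 k := h.isAffineAt_of_mem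
          (mem_Splus.2 ⟨by omega, .inl (by omega)⟩)
          (h0 _ _ (by omega) (by omega) (by omega))
        have h₅ : IsAffineAt k T E F j (k + j) (k - j) :=
          h.isAffineAt_of_mem' (mem_Splus.2 ⟨by omega, .inr <| .inr <| .inr <| .inr <| .inr <|
            .inr <| .inr <| .inr <| .inr <| .inl (by omega)⟩)
            (h.isAffineAt_congr (by omega) (by omega) (by omega) (by omega) (by omega) (by omega)
              h₄)
        exact h.isAffineAt_of_two (by omega) (by omega) (by omega) (by omega) (by omega)
          (by omega) (by omega) (by omega) (by omega) h₃ h₅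
    · refine h.isAffineAt_of_extremes (m := d - 2 * k) (fun h₁ => ?_) (fun h₁ h₂ => by omega)
        (fun h₁ h₂ => by omega) ha hb (by omega)
      exact h.isAffineAt_of_mem (mem_Splus.2 ⟨by omega, .inr <| .inr <| .inl (by omega)⟩)
        (h0 _ _ (by omega) (by omega) (by omega))
  · obtain ⟨E, F, hk⟩ := h.exists_isAffineAt_slot k (2 * k)
    refine ⟨E, F, fun i a b => h.isAffineAt_of_slots hd (fun a b ha hb hs => ?_)
      (fun a b ha hb hs => hk a b ha hb (by omega)) (fun a b ha hb hs => ?_)⟩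
    · refine h.isAffineAt_of_extremes (m := 3 * k) (fun h₁ => by omega) (fun h₁ h₂ => ?_)
        (fun h₁ h₂ => by omega) ha hb (by omega)
      rw [show 3 * k - 2 * k = k by omega]
      exact h.isAffineAt_swap (h.isAffineAt_of_mem (mem_Splus.2 ⟨by omega, .inr <| .inr <| .inr <|
        .inr <| .inr <| .inr <| .inr <| .inl (by omega)⟩)
        (hk _ _ (by omega) (by omega) (by omega)))
    · refine h.isAffineAt_of_extremes (m := k) (fun h₁ => ?_) (fun h₁ h₂ => by omega)
        (fun h₁ h₂ => by omega) ha hb (by omega)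
      exact h.isAffineAt_swap (h.isAffineAt_of_mem (mem_Splus.2 ⟨by omega, .inr <| .inr <| .inr <|
        .inr <| .inr <| .inr <| .inr <| .inr <| .inl (by omega)⟩)
        (hk _ _ (by omega) (by omega) (by omega)))

lemma exists_isAffineAt (hk2 : 2 ≤ k) (h : CosyzygyRelations k T) (d : ℕ) :
    ∃ E F, ∀ i a b, i ≤ 2 * k → a ≤ 2 * k → b ≤ 2 * k → i + a + b = d →
      IsAffineAt k T E F i a b := by
  rcases le_or_gt d (3 * k) with hd | hd
  · exact h.exists_isAffineAt_of_le hk2 hd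
  · obtain ⟨E, F, hEF⟩ := (h.reflect (by omega)).exists_isAffineAt_of_le hk2 (d := 6 * k - d)
      (by omega)
    refine ⟨E + (3 * k - d : ℂ) • F, F, fun i a b hi ha hb hs => ?_⟩
    have := hEF (2 * k - i) (2 * k - a) (2 * k - b) (by omega) (by omega) (by omega) (by omega)
    have e : (i : ℂ) + a + b = d := by exact_mod_cast hs
    simp only [IsAffineAt, epsCoeff_reflect, Nat.sub_sub_self, hi, ha, hb] at this ⊢
    rw [this, ← e]
    module

end CosyzygyRelations

/-- The element `u^(m-k-1) ε` of `A`, of weight `m`. -/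
def epsMonomial (k m : ℕ) : A := uu ^ (m - k - 1) * ee

lemma ee_mul_ee : ee * ee = 0 := DualNumber.eps_mul_eps

lemma epsCoeff_of_le {k i : ℕ} (h : i ≤ k) : epsCoeff k i = 0 := by
  simp [epsCoeff, Nat.sub_eq_zero_of_le h]

lemma x_eq (k i : ℕ) : x k i = uu ^ i + epsCoeff k i • epsMonomial k i := by
  unfold x
  split_ifs with h
  · simp [epsCoeff_of_le h]
  · rw [epsCoeff, epsMonomial, Nat.cast_smul_eq_nsmul, nsmul_eq_mul, mul_assoc]

lemma epsMonomial_mul_epsMonomial (k m n : ℕ) : epsMonomial k m * epsMonomial k n = 0 := by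
  unfold epsMonomial
  linear_combination uu ^ (m - k - 1) * uu ^ (n - k - 1) * ee_mul_ee

lemma uu_pow_mul_smul_epsMonomial (k j i : ℕ) :
    uu ^ j * (epsCoeff k i • epsMonomial k i) = epsCoeff k i • epsMonomial k (j + i) := by
  rcases le_or_gt i k with h | h
  · simp [epsCoeff_of_le h]
  · rw [mul_smul_comm, epsMonomial, epsMonomial, ← mul_assoc, ← pow_add]
    congr 4
    omega

lemma x_mul_x (k i j : ℕ) : x k i * x k j =
    uu ^ (i + j) + (epsCoeff k i + epsCoeff k j) • epsMonomial k (i + j) := by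
  have h : (epsCoeff k i • epsMonomial k i) * (epsCoeff k j • epsMonomial k j) = 0 := by
    rw [smul_mul_smul_comm, epsMonomial_mul_epsMonomial, smul_zero]
  have h₁ := uu_pow_mul_smul_epsMonomial k i j
  have h₂ := uu_pow_mul_smul_epsMonomial k j i
  rw [add_comm j i] at h₂
  rw [x_eq, x_eq, add_smul, ← h₁, ← h₂]
  linear_combination h

lemma x_mul_x_mul_x (k i a b : ℕ) : x k i * (x k a * x k b) = uu ^ (i + a + b) +
    (epsCoeff k i + epsCoeff k a + epsCoeff k b) • epsMonomial k (i + a + b) := by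
  have h : (epsCoeff k i • epsMonomial k i) *
      ((epsCoeff k a + epsCoeff k b) • epsMonomial k (a + b)) = 0 := by
    rw [smul_mul_smul_comm, epsMonomial_mul_epsMonomial, smul_zero]
  have h₁ := uu_pow_mul_smul_epsMonomial k (a + b) i
  have h₄ : uu ^ i * ((epsCoeff k a + epsCoeff k b) • epsMonomial k (a + b)) =
      (epsCoeff k a + epsCoeff k b) • epsMonomial k (i + a + b) := by
    by_cases hab : a ≤ k ∧ b ≤ k
    · simp [epsCoeff_of_le hab.1, epsCoeff_of_le hab.2]
    · rw [mul_smul_comm, epsMonomial, epsMonomial, ← mul_assoc, ← pow_add]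
      congr 3
      omega
  rw [show a + b + i = i + a + b by ring] at h₁
  rw [x_mul_x, x_eq, add_assoc (epsCoeff k i), add_smul (epsCoeff k i), ← h₁, ← h₄]
  linear_combination h

lemma uu_pow (m : ℕ) : (uu ^ m : A) =
    (TrivSqZeroExt.inl (Polynomial.X ^ m) : DualNumber (Polynomial ℂ)) :=
  (TrivSqZeroExt.inl_pow (M := Polynomial ℂ) (Polynomial.X : Polynomial ℂ) m)

lemma epsMonomial_eq (k m : ℕ) : epsMonomial k m =
    (TrivSqZeroExt.inr (Polynomial.X ^ (m - k - 1)) : DualNumber (Polynomial ℂ)) := by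
  rw [epsMonomial, uu_pow]
  refine (TrivSqZeroExt.inl_mul_inr (M := Polynomial ℂ) _ _).trans ?_
  simp

/-- The projection `p + q ε ↦ p`. -/
def polyFst : A →ₗ[ℂ] Polynomial ℂ :=
  (TrivSqZeroExt.fstHom ℂ (Polynomial ℂ) (Polynomial ℂ)).toLinearMap

/-- The projection `p + q ε ↦ q`. -/
def polySnd : A →ₗ[ℂ] Polynomial ℂ :=
  (TrivSqZeroExt.sndHom (Polynomial ℂ) (Polynomial ℂ)).restrictScalars ℂ

lemma polyFst_uu_pow (m : ℕ) : polyFst (uu ^ m) = Polynomial.X ^ m := by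
  rw [uu_pow]
  rfl

lemma polyFst_epsMonomial (k m : ℕ) : polyFst (epsMonomial k m) = 0 := by
  rw [epsMonomial_eq]
  rfl

lemma polySnd_uu_pow (m : ℕ) : polySnd (uu ^ m) = 0 := by
  rw [uu_pow]
  rfl

lemma polySnd_epsMonomial (k m : ℕ) :
    polySnd (epsMonomial k m) = Polynomial.X ^ (m - k - 1) := by
  rw [epsMonomial_eq]
  rfl

lemma exists_linearMap_polynomial {M : Type*} [AddCommGroup M] [Module ℂ M] (E : ℕ → M) :
    ∃ φ : Polynomial ℂ →ₗ[ℂ] M, ∀ d, φ (Polynomial.X ^ d) = E d :=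
  ⟨(Polynomial.basisMonomials ℂ).constr ℂ E, fun d => by
    simpa [Polynomial.monomial_one_right_eq_X_pow] using
      (Polynomial.basisMonomials ℂ).constr_basis ℂ E d⟩

lemma exists_linearMap_A {M : Type*} [AddCommGroup M] [Module ℂ M] (k : ℕ) (E F : ℕ → M) :
    ∃ Φ : A →ₗ[ℂ] M, (∀ d, Φ (uu ^ d) = E d) ∧ ∀ d, k < d → Φ (epsMonomial k d) = F d := by
  obtain ⟨φ, hφ⟩ := exists_linearMap_polynomial E
  obtain ⟨ψ, hψ⟩ := exists_linearMap_polynomial fun j => F (j + k + 1)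
  refine ⟨φ ∘ₗ polyFst + ψ ∘ₗ polySnd, fun d => ?_, fun d hd => ?_⟩
  · rw [LinearMap.add_apply, LinearMap.comp_apply, LinearMap.comp_apply, polyFst_uu_pow,
      polySnd_uu_pow, hφ, map_zero, add_zero]
  · rw [LinearMap.add_apply, LinearMap.comp_apply, LinearMap.comp_apply, polyFst_epsMonomial,
      polySnd_epsMonomial, hψ, map_zero, zero_add, show d - k - 1 + k + 1 = d by omega]

lemma coe_xW {k i : ℕ} (h : i ≤ 2 * k) : (xW k i : A) = x k i := by simp [xW, h]

lemma coe_xV2 {k i j : ℕ} (hi : i ≤ 2 * k) (hj : j ≤ 2 * k) :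
    (xV2 k i j : A) = x k i * x k j := by simp [xV2, hi, hj]

lemma f1_tmul (k : ℕ) (w : W k) (q : V k 2) : f1 k (w ⊗ₜ q) = (w : A) * q := rfl

lemma xV2_comm (k i j : ℕ) : xV2 k i j = xV2 k j i := by
  by_cases h : i ≤ 2 * k ∧ j ≤ 2 * k
  · exact Subtype.ext (by rw [coe_xV2 h.1 h.2, coe_xV2 h.2 h.1, mul_comm])
  · rw [xV2, xV2, dif_neg h, dif_neg (by omega)]

lemma span_xW (k : ℕ) : Submodule.span ℂ (xW k '' Set.Iic (2 * k)) = ⊤ := by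
  apply Submodule.map_injective_of_injective (W k).injective_subtype
  rw [Submodule.map_span, Submodule.map_top, Submodule.range_subtype, Set.image_image]
  conv_rhs => rw [W]
  exact congrArg _ (Set.image_congr fun i hi => coe_xW hi)

lemma V_two (k : ℕ) : V k 2 = Submodule.span ℂ
    ((fun p : ℕ × ℕ => x k p.1 * x k p.2) '' (Set.Iic (2 * k) ×ˢ Set.Iic (2 * k))) := by
  rw [V]
  congr 1
  ext a
  constructor
  · rintro ⟨f, hf, rfl⟩
    exact ⟨(f 0, f 1), ⟨hf 0, hf 1⟩, by simp [Fin.prod_univ_two]⟩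
  · rintro ⟨p, hp, rfl⟩
    refine ⟨![p.1, p.2], fun j => ?_, by simp [Fin.prod_univ_two]⟩
    fin_cases j
    exacts [hp.1, hp.2]

lemma span_xV2 (k : ℕ) : Submodule.span ℂ
    ((fun p : ℕ × ℕ => xV2 k p.1 p.2) '' (Set.Iic (2 * k) ×ˢ Set.Iic (2 * k))) = ⊤ := by
  apply Submodule.map_injective_of_injective (V k 2).injective_subtype
  rw [Submodule.map_span, Submodule.map_top, Submodule.range_subtype, Set.image_image]
  conv_rhs => rw [V_two]
  exact congrArg _ (Set.image_congr fun p hp => coe_xV2 hp.1 hp.2)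

lemma linearMap_ext_tmul {k : ℕ} {M : Type*} [AddCommGroup M] [Module ℂ M]
    {Q Q' : (↥(W k) ⊗[ℂ] ↥(V k 2)) →ₗ[ℂ] M}
    (h : ∀ i a b, i ≤ 2 * k → a ≤ 2 * k → b ≤ 2 * k →
      Q (xW k i ⊗ₜ xV2 k a b) = Q' (xW k i ⊗ₜ xV2 k a b)) : Q = Q' := by
  refine TensorProduct.ext (LinearMap.ext_on (span_xW k) ?_)
  rintro _ ⟨i, hi, rfl⟩
  refine LinearMap.ext_on (span_xV2 k) ?_
  rintro _ ⟨⟨a, b⟩, ⟨ha, hb⟩, rfl⟩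
  exact h i a b hi ha hb

lemma f1_tmul_xV2 {k i a b : ℕ} (hi : i ≤ 2 * k) (ha : a ≤ 2 * k) (hb : b ≤ 2 * k) :
    f1 k (xW k i ⊗ₜ xV2 k a b) = uu ^ (i + a + b) +
      (epsCoeff k i + epsCoeff k a + epsCoeff k b) • epsMonomial k (i + a + b) := by
  rw [f1_tmul, coe_xW hi, coe_xV2 ha hb, x_mul_x_mul_x]

/-- The subspace of `W ⊗ V₂` spanned by `C⁺`. -/
def spanSplus (k : ℕ) : Submodule ℂ (↥(W k) ⊗[ℂ] ↥(V k 2)) :=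
  Submodule.span ℂ ((fun t : ℕ × ℕ × ℕ => cosz k t.1 t.2.1 t.2.2) '' ↑(Splus k))

lemma cosyzygyRelations_of_linearMap {k : ℕ} {M : Type*} [AddCommGroup M] [Module ℂ M]
    (Q : (↥(W k) ⊗[ℂ] ↥(V k 2)) →ₗ[ℂ] M)
      (hQ : ∀ a b c, (a, b, c) ∈ Splus k → Q (cosz k a b c) = 0) :
    CosyzygyRelations k fun i a b => Q (xW k i ⊗ₜ xV2 k a b) where
  symm i a b := by rw [xV2_comm]
  affine i a b a' b' a'' b'' ha hb ha' hb' ha'' hb'' h₁ h₂ := by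
    simp only [← map_smul, ← map_add, ← TensorProduct.tmul_smul, ← TensorProduct.tmul_add]
    refine Eq.trans (b := Q (xW k i ⊗ₜ (0 : V k 2))) (congrArg (fun v => Q (xW k i ⊗ₜ v)) ?_) ?_
    swap
    · rw [TensorProduct.tmul_zero, map_zero]
    ext
    simp only [Submodule.coe_add, Submodule.coe_smul, ZeroMemClass.coe_zero]
    rw [coe_xV2 ha hb, coe_xV2 ha' hb', coe_xV2 ha'' hb'', x_mul_x, x_mul_x, x_mul_x, ← h₁, ← h₂]
    module
  congr i a b a' b' ha hb ha' hb' h₁ h₂ := by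
    congr 2
    ext
    rw [coe_xV2 ha hb, coe_xV2 ha' hb', x_mul_x, x_mul_x, h₁, h₂]
  rel a b c h := by
    rw [← sub_eq_zero, ← map_sub]
    exact hQ a b c h

lemma le_of_forall_le_ker {N : Type*} [AddCommGroup N] [Module ℂ N] {p q : Submodule ℂ N}
    (h : ∀ f : N →ₗ[ℂ] ℂ, p ≤ LinearMap.ker f → q ≤ LinearMap.ker f) : q ≤ p := by
  intro y hy
  by_contra hyp
  obtain ⟨f, hf, hpf⟩ := Submodule.exists_le_ker_of_notMem hyp
  exact hf (h f hpf hy)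

lemma ker_f1_le_ker {k : ℕ} (hk : 2 ≤ k) {M : Type*} [AddCommGroup M] [Module ℂ M]
    (Q : (↥(W k) ⊗[ℂ] ↥(V k 2)) →ₗ[ℂ] M)
      (hQ : ∀ a b c, (a, b, c) ∈ Splus k → Q (cosz k a b c) = 0) :
    LinearMap.ker (f1 k) ≤ LinearMap.ker Q := by
  choose E F hEF using (cosyzygyRelations_of_linearMap Q hQ).exists_isAffineAt hk
  obtain ⟨Φ, hE, hF⟩ := exists_linearMap_A k E F
  have key : Φ ∘ₗ f1 k = Q := by
    refine linearMap_ext_tmul fun i a b hi ha hb => ?_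
    have h := hEF (i + a + b) i a b hi ha hb rfl
    have hc : (epsCoeff k i + epsCoeff k a + epsCoeff k b) •
        Φ (epsMonomial k (i + a + b)) =
        (epsCoeff k i + epsCoeff k a + epsCoeff k b) • F (i + a + b) := by
      rcases le_or_gt (i + a + b) k with hle | hlt
      · simp only [epsCoeff_of_le (show i ≤ k by omega), epsCoeff_of_le (show a ≤ k by omega),
          epsCoeff_of_le (show b ≤ k by omega), add_zero, zero_smul]
      · rw [hF _ hlt]
    refine Eq.trans ?_ h.symm
    rw [LinearMap.comp_apply, f1_tmul_xV2 hi ha hb, map_add, map_smul, hE, hc]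
  intro t ht
  rw [← key, LinearMap.mem_ker, LinearMap.comp_apply, ht, map_zero]

lemma spanSplus_eq_ker {k : ℕ} (hk : 2 ≤ k) : spanSplus k = LinearMap.ker (f1 k) := by
  apply le_antisymm
  · refine Submodule.span_le.2 ?_
    rintro _ ⟨⟨a, b, c⟩, h, rfl⟩
    obtain ⟨⟨ha, hb, hc⟩, -⟩ := mem_Splus.1 h
    simp only [SetLike.mem_coe, LinearMap.mem_ker, cosz, map_sub, f1_tmul, coe_xW, coe_xV2, *]
    ring
  · refine le_of_forall_le_ker (N := ↥(W k) ⊗[ℂ] ↥(V k 2)) fun Q hQ => ?_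
    exact ker_f1_le_ker hk Q fun a b c h => hQ (Submodule.subset_span ⟨_, h, rfl⟩)

lemma epsMonomial_of_le {k m : ℕ} (h : m ≤ k) : epsMonomial k m = epsMonomial k (k + 1) := by
  rw [epsMonomial, epsMonomial, show m - k - 1 = k + 1 - k - 1 by omega]

/-- A basis of `A`, indexed by the exponents of `u` in the two components. -/
def basisFamily (k : ℕ) (c : ℕ → ℂ) : ℕ ⊕ ℕ → A :=
  Sum.elim (fun m => uu ^ m + c m • epsMonomial k m) fun j => epsMonomial k (k + 1 + j)

lemma linearIndependent_basisFamily (k : ℕ) (c : ℕ → ℂ) :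
    LinearIndependent ℂ (basisFamily k c) := by
  let F : ℕ → (ℕ ⊕ ℕ →₀ ℂ) := fun d => Finsupp.single (Sum.inr (d - k - 1)) 1
  obtain ⟨Φ, hE, hF⟩ := exists_linearMap_A k
    (fun d => Finsupp.single (Sum.inl d) (1 : ℂ) - c d • F d) F
  have hF' : ∀ d, Φ (epsMonomial k d) = F d := fun d => by
    rcases le_or_gt d k with h | h
    · rw [epsMonomial_of_le h, hF _ (Nat.lt_succ_self k)]
      simp only [F, show k + 1 - k - 1 = d - k - 1 by omega]
    · exact hF d h
  refine LinearIndependent.of_comp Φ ?_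
  have h : Φ ∘ basisFamily k c = Finsupp.basisSingleOne (R := ℂ) := by
    funext s
    rcases s with m | j
    · simp [basisFamily, hE, hF']
    · simp [basisFamily, hF', F, show k + 1 + j - k - 1 = j by omega]
  rw [h]
  exact Finsupp.basisSingleOne.linearIndependent

lemma card_le_finrank_of_basisFamily_mem {ι : Type*} [Fintype ι] {k : ℕ} {c : ℕ → ℂ}
    {p : Submodule ℂ A} [FiniteDimensional ℂ p] {f : ι → ℕ ⊕ ℕ} (hf : Function.Injective f)
    (h : ∀ i, basisFamily k c (f i) ∈ p) : Fintype.card ι ≤ Module.finrank ℂ p := by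
  have hli := (linearIndependent_basisFamily k c).comp f hf
  exact (LinearIndependent.of_comp (v := fun i => (⟨_, h i⟩ : p)) p.subtype
    hli).fintype_card_le_finrank

instance (k : ℕ) : FiniteDimensional ℂ (W k) :=
  FiniteDimensional.span_of_finite ℂ ((Set.finite_Iic _).image _)

instance (k : ℕ) : FiniteDimensional ℂ (V k 2) := by
  rw [V_two]
  exact FiniteDimensional.span_of_finite ℂ (((Set.finite_Iic _).prod (Set.finite_Iic _)).image _)

lemma le_finrank_W (k : ℕ) : 2 * k + 1 ≤ Module.finrank ℂ (W k) := by
  simpa using card_le_finrank_of_basisFamily_mem (k := k) (c := epsCoeff k) (p := W k)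
    (f := fun i : Fin (2 * k + 1) => Sum.inl i.1) (fun i j h => Fin.ext (Sum.inl.inj h))
    fun i => Submodule.subset_span ⟨i, Nat.lt_succ_iff.1 i.2, x_eq k i⟩

lemma x_mul_x_mem {k i j : ℕ} (hi : i ≤ 2 * k) (hj : j ≤ 2 * k) :
    uu ^ (i + j) + (epsCoeff k i + epsCoeff k j) • epsMonomial k (i + j) ∈ V k 2 := by
  rw [← x_mul_x, ← coe_xV2 hi hj]
  exact Subtype.coe_prop _

lemma epsMonomial_mem {k i j i' j' : ℕ} (hi : i ≤ 2 * k) (hj : j ≤ 2 * k) (hi' : i' ≤ 2 * k)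
    (hj' : j' ≤ 2 * k) (h : i + j = i' + j')
    (hne : epsCoeff k i + epsCoeff k j ≠ epsCoeff k i' + epsCoeff k j') :
    epsMonomial k (i + j) ∈ V k 2 := by
  have key := sub_mem (x_mul_x_mem hi hj) (x_mul_x_mem hi' hj')
  rw [← h, add_sub_add_left_eq_sub, ← sub_smul] at key
  exact (Submodule.smul_mem_iff _ (sub_ne_zero.2 hne)).1 key

lemma le_finrank_V_two {k : ℕ} (hk : 1 ≤ k) : 6 * k ≤ Module.finrank ℂ (V k 2) := by
  refine le_trans (le_of_eq ?_) (card_le_finrank_of_basisFamily_mem (k := k)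
    (c := fun m => if m ≤ 2 * k then epsCoeff k m else epsCoeff k (2 * k) + epsCoeff k (m - 2 * k))
    (f := Sum.map (Fin.val : Fin (4 * k + 1) → ℕ) (Fin.val : Fin (2 * k - 1) → ℕ))
    (Fin.val_injective.sumMap Fin.val_injective) ?_)
  · simp only [Fintype.card_sum, Fintype.card_fin]
    omega
  · rintro (⟨m, hm⟩ | ⟨j, hj⟩)
    · simp only [basisFamily, Sum.map_inl, Sum.elim_inl]
      split_ifs with h
      · simpa [epsCoeff] using x_mul_x_mem (Nat.zero_le (2 * k)) h
      · have := x_mul_x_mem (k := k) le_rfl (show m - 2 * k ≤ 2 * k by omega)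
        rwa [show 2 * k + (m - 2 * k) = m by omega] at this
    · simp only [basisFamily, Sum.map_inr, Sum.elim_inr]
      rcases le_or_gt (j + 1) k with h | h
      · have := epsMonomial_mem (k := k) (i := 0) (j := k + 1 + j) (i' := k) (j' := j + 1)
          (by omega) (by omega) (by omega) (by omega) (by omega) (by
            simp only [epsCoeff, ← Nat.cast_add, ne_eq, Nat.cast_inj]; omega)
        rwa [zero_add] at this
      · have := epsMonomial_mem (k := k) (i := 2 * k) (j := j + 1 - k) (i' := k) (j' := j + 1)
          (by omega) (by omega) (by omega) (by omega) (by omega) (by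
            simp only [epsCoeff, ← Nat.cast_add, ne_eq, Nat.cast_inj]; omega)
        rwa [show 2 * k + (j + 1 - k) = k + 1 + j by omega] at this

lemma finrank_range_f1_le {k : ℕ} (hk : 1 ≤ k) :
    Module.finrank ℂ (LinearMap.range (f1 k)) ≤ 10 * k := by
  classical
  let c : ℕ → ℂ := fun d => if 5 * k ≤ d then ((d - 3 * k : ℕ) : ℂ) else 0
  let s : Finset A := (Finset.range (6 * k + 1)).image (fun d => uu ^ d + c d • epsMonomial k d) ∪
    (Finset.Ico (k + 1) (5 * k)).image (epsMonomial k)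
  have hs : LinearMap.range (f1 k) ≤ Submodule.span ℂ (s : Set A) := by
    rw [← Submodule.ker_mkQ (Submodule.span ℂ (s : Set A)), LinearMap.range_le_ker_iff]
    refine linearMap_ext_tmul fun i a b hi ha hb => ?_
    rw [LinearMap.comp_apply, f1_tmul_xV2 hi ha hb, LinearMap.zero_apply, Submodule.mkQ_apply,
      Submodule.Quotient.mk_eq_zero]
    have hd : uu ^ (i + a + b) + c (i + a + b) • epsMonomial k (i + a + b) ∈
        Submodule.span ℂ (s : Set A) := Submodule.subset_span <| Finset.mem_union_left _ <|
      Finset.mem_image_of_mem (fun d => uu ^ d + c d • epsMonomial k d)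
        (Finset.mem_range.2 (by omega))
    by_cases h : k < i + a + b ∧ i + a + b < 5 * k
    · have he : epsMonomial k (i + a + b) ∈ Submodule.span ℂ (s : Set A) :=
        Submodule.subset_span <| Finset.mem_union_right _ <|
          Finset.mem_image_of_mem _ (Finset.mem_Ico.2 h)
      simp only [c, if_neg (not_le.2 h.2), zero_smul, add_zero] at hd
      exact add_mem hd (Submodule.smul_mem _ _ he)
    · convert hd using 3
      simp only [c, epsCoeff]
      split_ifs
      · norm_cast
        omega
      · norm_cast
        omega
  refine (Submodule.finrank_mono hs).trans ((finrank_span_finset_le_card s).trans ?_)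
  refine (Finset.card_union_le _ _).trans
    ((add_le_add Finset.card_image_le Finset.card_image_le).trans ?_)
  simp only [Finset.card_range, Nat.card_Ico]
  omega

lemma le_finrank_ker_tensorProduct {M N P : Type*} [AddCommGroup M] [Module ℂ M]
    [AddCommGroup N] [Module ℂ N] [AddCommGroup P] [Module ℂ P] [FiniteDimensional ℂ M]
    [FiniteDimensional ℂ N] (f : M ⊗[ℂ] N →ₗ[ℂ] P) {m n r : ℕ} (hm : m ≤ Module.finrank ℂ M)
    (hn : n ≤ Module.finrank ℂ N) (hr : Module.finrank ℂ (LinearMap.range f) ≤ r) :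
    m * n ≤ r + Module.finrank ℂ (LinearMap.ker f) := by
  have h := f.finrank_range_add_finrank_ker
  rw [Module.finrank_tensorProduct] at h
  have := Nat.mul_le_mul hm hn
  omega

lemma linearIndepOn_of_card_le {N ι : Type*} [AddCommGroup N] [Module ℂ N] (s : Finset ι)
    (v : ι → N) (h : s.card ≤ Module.finrank ℂ (Submodule.span ℂ (v '' s))) :
    LinearIndependent ℂ fun t : s => v t := by
  rw [linearIndependent_iff_card_le_finrank_span, Fintype.card_coe]
  rwa [Set.image_eq_range] at h

lemma isMonomialBasisOfCosyzygies_Splus {k : ℕ} (hk : 2 ≤ k)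
    (hcard : (Splus k).card + 10 * k ≤ (2 * k + 1) * (6 * k)) :
    IsMonomialBasisOfCosyzygies k (Splus k) := by
  refine ⟨linearIndepOn_of_card_le (N := ↥(W k) ⊗[ℂ] ↥(V k 2)) (Splus k)
    (fun t => cosz k t.1 t.2.1 t.2.2) ?_, spanSplus_eq_ker hk⟩
  have h := le_finrank_ker_tensorProduct (f1 k) (le_finrank_W k) (le_finrank_V_two (by omega))
    (finrank_range_f1_le (by omega))
  rw [← spanSplus_eq_ker hk, spanSplus] at h
  omega

lemma sum_Splus {k : ℕ} (hk : 2 ≤ k) (f : ℕ × ℕ × ℕ → ℕ) : ∑ t ∈ Splus k, f t =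
    (∑ b ∈ Finset.Ico 1 (2 * k), ∑ c ∈ Finset.range (2 * k), f (0, b, c)) +
    ((∑ b ∈ Finset.Ico 1 k, f (0, b, 2 * k)) +
    ((∑ c ∈ Finset.range k, f (0, 2 * k, c)) +
    ((∑ b ∈ Finset.Ico 1 (2 * k), ∑ c ∈ Finset.Ico 1 (2 * k + 1), f (2 * k, b, c)) +
    ((∑ c ∈ Finset.Ico (k + 1) (2 * k + 1), f (2 * k, 0, c)) +
    ((∑ b ∈ Finset.Ico (k + 1) (2 * k), f (2 * k, b, 0)) +
    ((∑ b ∈ (Finset.Ico 1 (2 * k)).erase k, ∑ c ∈ Finset.Ico 1 (2 * k), f (k, b, c)) +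
    (f (k, 0, 2 * k) + (f (k, 2 * k, 0) +
    ((∑ i ∈ Finset.Ico 1 k, f (i, k + i, k - i)) +
      ∑ i ∈ Finset.Ico 1 k, f (2 * k - i, k - i, k + i)))))))))) := by
  have hprod : ∀ (a : ℕ) (s t : Finset ℕ), ∑ b ∈ s, ∑ c ∈ t, f (a, b, c) =
      ∑ p ∈ {a} ×ˢ s ×ˢ t, f p := fun a s t => by
    simp [Finset.sum_product]
  have hmid : ∀ (a c : ℕ) (s : Finset ℕ), ∑ b ∈ s, f (a, b, c) =
      ∑ p ∈ {a} ×ˢ s ×ˢ {c}, f p := fun a c s => by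
    simp
  have hlast : ∀ (a b : ℕ) (s : Finset ℕ), ∑ c ∈ s, f (a, b, c) =
      ∑ p ∈ {a} ×ˢ {b} ×ˢ s, f p := fun a b s => by
    simp
  have h₁ : ∑ i ∈ Finset.Ico 1 k, f (i, k + i, k - i) =
      ∑ p ∈ (Finset.Ico 1 k).image (fun i => (i, k + i, k - i)), f p :=
    (Finset.sum_image fun i _ j _ h => congrArg Prod.fst h).symm
  have h₂ : ∑ i ∈ Finset.Ico 1 k, f (2 * k - i, k - i, k + i) =
      ∑ p ∈ (Finset.Ico 1 k).image (fun i => (2 * k - i, k - i, k + i)), f p :=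
    (Finset.sum_image fun i _ j _ h => by simp only [Prod.mk.injEq] at h; omega).symm
  have himage₁ : ∀ a b c, (∃ i, (1 ≤ i ∧ i < k) ∧ i = a ∧ k + i = b ∧ k - i = c) ↔
      1 ≤ a ∧ a < k ∧ b = k + a ∧ c = k - a := fun a b c =>
    ⟨by rintro ⟨i, h⟩; omega, fun h => ⟨a, by omega⟩⟩
  have himage₂ : ∀ a b c, (∃ i, (1 ≤ i ∧ i < k) ∧ 2 * k - i = a ∧ k - i = b ∧ k + i = c) ↔
      k < a ∧ a < 2 * k ∧ b = a - k ∧ c = 3 * k - a := fun a b c =>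
    ⟨by rintro ⟨i, h⟩; omega, fun h => ⟨2 * k - a, by omega⟩⟩
  rw [hprod, hprod, hprod, hmid, hmid, hlast, hlast, h₁, h₂,
    ← Finset.sum_singleton f (k, 0, 2 * k), ← Finset.sum_singleton f (k, 2 * k, 0)]
  repeat rw [← Finset.sum_union]
  · congr 1
    ext ⟨a, b, c⟩
    rw [mem_Splus]
    simp only [Finset.mem_union, Finset.mem_product, Finset.mem_singleton, Finset.mem_image,
      Finset.mem_Ico, Finset.mem_range, Finset.mem_erase, Prod.mk.injEq]
    rw [himage₁, himage₂]
    refine ⟨fun ⟨_, h⟩ => Or.imp ?_ (Or.imp ?_ (Or.imp ?_ (Or.imp ?_ (Or.imp ?_ (Or.imp ?_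
      (Or.imp ?_ (Or.imp ?_ (Or.imp ?_ (Or.imp ?_ ?_))))))))) h, fun h => ⟨?_, Or.imp ?_
      (Or.imp ?_ (Or.imp ?_ (Or.imp ?_ (Or.imp ?_ (Or.imp ?_ (Or.imp ?_ (Or.imp ?_ (Or.imp ?_
      (Or.imp ?_ ?_))))))))) h⟩⟩
    · rcases h with h | h | h | h | h | h | h | h | h | h | h <;> omega
    all_goals omega
  all_goals
    rw [Finset.disjoint_left]
    rintro ⟨a, b, c⟩
    simp only [Finset.mem_union, Finset.mem_product, Finset.mem_singleton, Finset.mem_image,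
      Finset.mem_Ico, Finset.mem_range, Finset.mem_erase, Prod.mk.injEq, himage₁, himage₂, not_or]
    intro h
    repeat' apply And.intro
    all_goals omega

lemma card_Splus {k : ℕ} (hk : 2 ≤ k) :
    (Splus k).card = (3 * (2 * k + 1) - 5) * ((2 * k + 1) - 1) := by
  rw [Finset.card_eq_sum_ones, sum_Splus hk]
  have hmem : k ∈ Finset.Ico 1 (2 * k) := Finset.mem_Ico.2 (by omega)
  simp only [Finset.sum_const, smul_eq_mul, Nat.card_Ico, Finset.card_range,
    Finset.card_erase_of_mem hmem]
  obtain ⟨n, rfl⟩ := Nat.exists_eq_add_of_le hk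
  simp only [show 2 * (2 + n) - 1 = 2 * n + 3 by omega, show 2 + n - 1 = n + 1 by omega,
    show 2 * (2 + n) + 1 - 1 = 2 * n + 4 by omega, show 2 * n + 3 - 1 = 2 * n + 2 by omega,
    show 2 * (2 + n) + 1 - (2 + n + 1) = n + 2 by omega,
    show 2 * (2 + n) - (2 + n + 1) = n + 1 by omega,
    show 3 * (2 * (2 + n) + 1) - 5 = 6 * n + 10 by omega]
  ring

lemma sum_indicator_eq {s : Finset ℕ} {g : ℕ → ℕ} {i m : ℕ} (h : ∀ j ∈ s, g j = i → j = m) :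
    (∑ j ∈ s, if g j = i then 1 else 0) = if m ∈ s ∧ g m = i then 1 else 0 := by
  split_ifs with hm
  · rw [Finset.sum_eq_single_of_mem m hm.1 fun j hj hne => if_neg fun hg => hne (h j hj hg),
      if_pos hm.2]
  · refine Finset.sum_eq_zero fun j hj => if_neg fun hg => hm ?_
    rw [← h j hj hg]
    exact ⟨hj, hg⟩

lemma occ_Splus {k : ℕ} (hk : 2 ≤ k) {i : ℕ} (hi : i ≤ 2 * k) : occ (Splus k) i =
    if i = 0 ∨ i = k ∨ i = 2 * k then (2 * k + 1) ^ 2 - 1 else 6 * (2 * k + 1) - 6 := by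
  have hmem : k ∈ Finset.Ico 1 (2 * k) := Finset.mem_Ico.2 (by omega)
  obtain ⟨δ, hδ⟩ : ∃ δ : ℕ → ℕ, ∀ j, δ j = if j = i then 1 else 0 := ⟨_, fun _ => rfl⟩
  have hsum (s : Finset ℕ) : ∑ j ∈ s, δ j = if i ∈ s then 1 else 0 := by
    simp only [hδ, Finset.sum_ite_eq']
  have h₁ : ∑ j ∈ Finset.Ico 1 k, δ (k + j) =
      if i - k ∈ Finset.Ico 1 k ∧ k + (i - k) = i then 1 else 0 := by
    simp only [hδ]
    exact sum_indicator_eq fun j hj h => by omega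
  have h₂ : ∑ j ∈ Finset.Ico 1 k, δ (k - j) =
      if k - i ∈ Finset.Ico 1 k ∧ k - (k - i) = i then 1 else 0 := by
    simp only [hδ]
    exact sum_indicator_eq fun j hj h => by have := Finset.mem_Ico.1 hj; omega
  have h₃ : ∑ j ∈ Finset.Ico 1 k, δ (2 * k - j) =
      if 2 * k - i ∈ Finset.Ico 1 k ∧ 2 * k - (2 * k - i) = i then 1 else 0 := by
    simp only [hδ]
    exact sum_indicator_eq fun j hj h => by have := Finset.mem_Ico.1 hj; omega
  simp only [occ, ← hδ]
  rw [sum_Splus hk]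
  simp only [Finset.sum_add_distrib, Finset.sum_const, smul_eq_mul, Nat.card_Ico,
    Finset.card_range, Finset.card_erase_of_mem hmem, ← Finset.mul_sum, hsum, h₁, h₂, h₃]
  simp only [hδ, Finset.mem_Ico, Finset.mem_erase, Finset.mem_range]
  obtain ⟨n, rfl⟩ := Nat.exists_eq_add_of_le hk
  simp only [show 2 * (2 + n) - 1 = 2 * n + 3 by omega, show 2 + n - 1 = n + 1 by omega,
    show 2 * (2 + n) + 1 - 1 = 2 * n + 4 by omega, show 2 * n + 3 - 1 = 2 * n + 2 by omega,
    show 2 * (2 + n) + 1 - (2 + n + 1) = n + 2 by omega,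
    show 2 * (2 + n) - (2 + n + 1) = n + 1 by omega,
    show 6 * (2 * (2 + n) + 1) - 6 = 12 * n + 24 by omega,
    show (2 * (2 + n) + 1) ^ 2 - 1 = (2 * n + 4) * (2 * n + 6) by
      rw [Nat.sub_eq_iff_eq_add (Nat.one_le_pow _ _ (by omega))]; ring]
  have hcases : i = 0 ∨ i = 2 + n ∨ i = 2 * (2 + n) ∨ (0 < i ∧ i < 2 + n) ∨
    (2 + n < i ∧ i < 2 * (2 + n)) := by omega
  rcases hcases with h | h | h | h | h
  all_goals
    simp (disch := omega) only [if_pos, if_neg]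
    ring

/-- `C⁺` is a monomial basis of cosyzygies, of cardinality `(3g−5)(g−1)`, whose `T`-state is
`(g²−1)(x_0 + x_k + x_{2k}) + (6g−6) Σ_{i ≠ 0,k,2k} x_i`. -/
theorem stmt_11 (k : ℕ) (hk : 2 ≤ k) :
    (Splus k).card = (3 * (2 * k + 1) - 5) * ((2 * k + 1) - 1) ∧
    IsMonomialBasisOfCosyzygies k (Splus k) ∧
    ∀ i ≤ 2 * k,
      occ (Splus k) i =
        if i = 0 ∨ i = k ∨ i = 2 * k then (2 * k + 1) ^ 2 - 1
        else 6 * (2 * k + 1) - 6 :=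
  ⟨card_Splus hk, isMonomialBasisOfCosyzygies_Splus hk (by
    rw [card_Splus hk]
    obtain ⟨n, rfl⟩ := Nat.exists_eq_add_of_le hk
    rw [show 3 * (2 * (2 + n) + 1) - 5 = 6 * n + 10 by omega, Nat.add_sub_cancel]
    exact le_of_eq (by ring)), fun _ hi => occ_Splus hk hi⟩
end
end

section
/- The vector in ℚ^g all of whose coordinates equal 3(3g−5)(g−1)/g lies in the convex hull of the set {w⁺, w⁻, w★} in ℚ^g. -/
set_option synthInstance.maxHeartbeats 400000
set_option maxHeartbeats 1000000

noncomputable section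

/-- The `T`-state of the monomial basis `C⁺`. -/
def wp (k : ℕ) : Fin (2 * k + 1) → ℚ := fun i =>
  if (i : ℕ) = 0 ∨ (i : ℕ) = k ∨ (i : ℕ) = 2 * k then (2 * k + 1 : ℚ) ^ 2 - 1
  else 6 * (2 * k + 1 : ℚ) - 6

/-- The `T`-state of the monomial basis `C⁻`. -/
def wm (k : ℕ) : Fin (2 * k + 1) → ℚ := fun i =>
  if (i : ℕ) = 0 ∨ (i : ℕ) = 2 * k then 7 * (2 * k + 1 : ℚ) - 12
  else if (i : ℕ) = k then 7 * (2 * k + 1 : ℚ) - 15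
  else 9 * (2 * k + 1 : ℚ) - 18

/-- The `T`-state of the monomial basis `C^⋆`. -/
def ws (k : ℕ) : Fin (2 * k + 1) → ℚ := fun i =>
  if (i : ℕ) = 0 ∨ (i : ℕ) = 2 * k then (15 * (2 * k + 1 : ℚ) - 29) / 2
  else if (i : ℕ) = k then 8 * (2 * k + 1 : ℚ) - 16
  else 9 * (2 * k + 1 : ℚ) - 20

/-- A convex set contains the convex combinations of any three of its points. -/
theorem Convex.add_smul_three_mem {E : Type*} [AddCommGroup E] [Module ℚ E] {S : Set E}
    (hS : Convex ℚ S) {a b c : ℚ} (ha : 0 ≤ a) (hb : 0 ≤ b) (hc : 0 ≤ c) (habc : a + b + c = 1)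
    {x y z : E} (hx : x ∈ S) (hy : y ∈ S) (hz : z ∈ S) : a • x + b • y + c • z ∈ S := by
  simpa [Fin.sum_univ_three] using hS.sum_mem (t := Finset.univ) (w := ![a, b, c])
    (z := ![x, y, z]) (by simp [Fin.forall_fin_succ, ha, hb, hc])
    (by simpa [Fin.sum_univ_three] using habc) (by simp [Fin.forall_fin_succ, hx, hy, hz])

/-- The barycenter `(3(3g−5)(g−1)/g, …, 3(3g−5)(g−1)/g)` lies in the convex hull of the
three `T`-states `w⁺`, `w⁻`, `w^⋆` (here `g = 2k+1`). -/
theorem stmt_17 (k : ℕ) (hk : 2 ≤ k) :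
    (fun _ : Fin (2 * k + 1) =>
        (3 * (3 * (2 * k + 1 : ℚ) - 5) * ((2 * k + 1 : ℚ) - 1)) / (2 * k + 1 : ℚ)) ∈
      convexHull ℚ {wp k, wm k, ws k} := by
  have hg : (5 : ℚ) ≤ 2 * k + 1 := by
    have : (2 : ℚ) ≤ k := by exact_mod_cast hk
    linarith
  unfold wp wm ws
  generalize (2 * k + 1 : ℚ) = g at hg ⊢
  have hg0 : 0 < g := by linarith
  have hq : 0 < g ^ 2 - g - 16 := by nlinarith
  have hD : 0 < g * (g ^ 2 - g - 16) := mul_pos hg0 hq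
  -- the barycentric weights, up to the common denominator `g * (g ^ 2 - g - 16)`
  have ha : 0 ≤ (2 * g ^ 2 - 3 * g - 15) / (g * (g ^ 2 - g - 16)) :=
    div_nonneg (by nlinarith) hD.le
  have hb : 0 ≤ (g - 3) * ((g - 1) * (g - 5)) / (g * (g ^ 2 - g - 16)) :=
    div_nonneg (mul_nonneg (by linarith) (mul_nonneg (by linarith) (by linarith))) hD.le
  have hc : 0 ≤ 6 * ((g - 1) * (g - 5)) / (g * (g ^ 2 - g - 16)) :=
    div_nonneg (mul_nonneg (by norm_num) (mul_nonneg (by linarith) (by linarith))) hD.le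
  have hsum : (2 * g ^ 2 - 3 * g - 15) / (g * (g ^ 2 - g - 16)) +
      (g - 3) * ((g - 1) * (g - 5)) / (g * (g ^ 2 - g - 16)) +
      6 * ((g - 1) * (g - 5)) / (g * (g ^ 2 - g - 16)) = 1 := by
    rw [← add_div, ← add_div, div_eq_one_iff_eq hD.ne']
    ring
  refine mem_convexHull_iff.2 fun S hS hconv => ?_
  simp only [Set.insert_subset_iff, Set.singleton_subset_iff] at hS
  obtain ⟨hp, hm, hs⟩ := hS
  convert hconv.add_smul_three_mem ha hb hc hsum hp hm hs using 1
  have hg1 : g ≠ 0 := hg0.ne'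
  have hq1 : g * (g - 1) - 16 ≠ 0 := by
    rw [show g * (g - 1) - 16 = g ^ 2 - g - 16 by ring]
    exact hq.ne'
  funext i
  simp only [Pi.add_apply, Pi.smul_apply, smul_eq_mul]
  by_cases h0 : (i : ℕ) = 0 ∨ (i : ℕ) = 2 * k
  · have h1 : (i : ℕ) = 0 ∨ (i : ℕ) = k ∨ (i : ℕ) = 2 * k := by tauto
    simp only [if_pos h0, if_pos h1]
    field_simp
    ring
  · by_cases h1 : (i : ℕ) = k
    · have h2 : (i : ℕ) = 0 ∨ (i : ℕ) = k ∨ (i : ℕ) = 2 * k := Or.inr (Or.inl h1)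
      simp only [if_neg h0, if_pos h1, if_pos h2]
      field_simp
      ring
    · have h2 : ¬((i : ℕ) = 0 ∨ (i : ℕ) = k ∨ (i : ℕ) = 2 * k) := by tauto
      simp only [if_neg h0, if_neg h1, if_neg h2]
      field_simp
      ring
end
end
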